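/- Let P = a₀·u·a₁·u·a₂·⋯·u·a_k be a Dyck prefix, where k ≥ 0 and each a_i is a Dyck path. Then f(duP) = Σ Π_{i=0}^k V(a_i, s_i) · J(s₀V₁), where the sum is taken over all sequences (s_i)_{i∈[0,k]} of Dyck paths with |s_i| = |a_i| and s_i ≥ a_i, and over all sequences (V_i)_{i∈[k+1]} of Dyck prefixes with V_i ≥ u·s_i·V_{i+1} for every i ∈ [k] and V_{k+1} = ε. -/

import Mathlib

/-- A binary path is a list of steps: `true` = upstep `u`, `false` = downstep `d`. -/
abbrev BinPath := List Bool

/-- `ht P k` is the height of the `k`-th point of the path `P` (the point reached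
after the first `k` steps). -/
def ht (P : BinPath) (k : ℕ) : ℤ :=
  ((P.take k).map (fun b => if b then (1 : ℤ) else -1)).sum

/-- The lattice order on binary paths of the same length: `P ≤ Q` iff
`hᵢ(P) ≤ hᵢ(Q)` for all `i`. -/
def pathLe (P Q : BinPath) : Prop :=
  P.length = Q.length ∧ ∀ k, ht P k ≤ ht Q k

def pathLt (P Q : BinPath) : Prop := pathLe P Q ∧ P ≠ Q

/-- The maximum path `1ₙ = uⁿ`. -/
def maxPath (n : ℕ) : BinPath := List.replicate n true

/-- Step `i` (0-based) of `P` is a downstep whose endpoint is a valley, i.e. it is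
followed by an upstep or it is the last step of `P`. -/
def isValley (P : BinPath) (i : ℕ) : Prop :=
  i < P.length ∧ P.getD i true = false ∧ P.getD (i + 1) true = true

/-- The number of valleys of `P`. -/
def numValleys (P : BinPath) : ℕ :=
  ((Finset.range P.length).filter
    (fun i => P.getD i true = false ∧ P.getD (i + 1) true = true)).card

/-- The filling of `P`: every valley of `P` is turned into a peak
(each occurrence `du` whose middle point is a valley becomes `ud`, and a final
valley-`d` becomes `u`). -/
def fill (P : BinPath) : BinPath :=
  List.ofFn (fun i : Fin P.length =>
    if P.get i then P.getD (i.1 - 1) true else P.getD (i.1 + 1) true)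

/-- The degree of `P`: the least `k` such that the `k`-fold iterated filling
of `P` is the maximum path. -/
noncomputable def degree (P : BinPath) : ℕ :=
  sInf {k | fill^[k] P = maxPath P.length}

/-- `fPath P` is the number of chains from `P` to the maximum path `1_{|P|}` of
length `degree P` having small intervals. -/
noncomputable def fPath (P : BinPath) : ℕ :=
  Set.ncard {c : ℕ → BinPath |
    c 0 = P ∧ (∀ i, degree P ≤ i → c i = maxPath P.length) ∧
    ∀ i < degree P, pathLt (c i) (c (i + 1)) ∧ pathLe (c (i + 1)) (fill (c i))}

/-- Height of the lowest valley of `P`. -/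
noncomputable def lv (P : BinPath) : ℤ :=
  sInf {h : ℤ | ∃ i, isValley P i ∧ ht P (i + 1) = h}

/-- Height of the highest valley of `P`. -/
noncomputable def hv (P : BinPath) : ℤ :=
  sSup {h : ℤ | ∃ i, isValley P i ∧ ht P (i + 1) = h}

noncomputable def hvNat (P : BinPath) : ℕ := (hv P).toNat

/-- `P′`: every low valley of `P` is turned into a peak. -/
noncomputable def lowFill (P : BinPath) : BinPath :=
  List.ofFn (fun i : Fin P.length =>
    if P.get i then
      (if P.getD (i.1 - 1) true = false ∧ ht P i.1 = lv P then false else true)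
    else
      (if P.getD (i.1 + 1) true = true ∧ ht P (i.1 + 1) = lv P then true else false))

/-- `P*`: every valley of `P` is turned into a peak, except the last one when `P`
ends with a downstep. -/
def starFill (P : BinPath) : BinPath :=
  List.ofFn (fun i : Fin P.length =>
    if i.1 + 1 = P.length ∧ P.get i = false then false
    else if P.get i then P.getD (i.1 - 1) true else P.getD (i.1 + 1) true)

/-- A Dyck path: starts and ends at height 0 and lies weakly above height 0. -/
def IsDyck (P : BinPath) : Prop := ht P P.length = 0 ∧ ∀ k, 0 ≤ ht P k

/-- A Dyck prefix: a prefix of a Dyck path. -/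
def IsDyckPrefix (P : BinPath) : Prop := ∃ Q : BinPath, IsDyck (P ++ Q)

/-- A Dyck suffix: a suffix of a Dyck path. -/
def IsDyckSuffix (P : BinPath) : Prop := ∃ Q : BinPath, IsDyck (Q ++ P)

/-- The pyramid `u^m d^m`. -/
def pyramid (m : ℕ) : BinPath := List.replicate m true ++ List.replicate m false

/-- Cardinality of the interval `[P, Q]` in the lattice of binary paths. -/
noncomputable def intervalCard (P Q : BinPath) : ℕ :=
  Set.ncard {R : BinPath | pathLe P R ∧ pathLe R Q}

/-- `I(s) = |[s, u^{|s|/2} d^{|s|/2}]|`. -/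
noncomputable def Ifun (s : BinPath) : ℕ := intervalCard s (pyramid (s.length / 2))

/-- `J(P) = |[P, u^{|P|}]|`. -/
noncomputable def Jfun (P : BinPath) : ℕ := intervalCard P (maxPath P.length)

/-- `P` and `Q` have exactly the same valleys at every height at most `m`. -/
def sameValleysUpTo (P Q : BinPath) (m : ℤ) : Prop :=
  ∀ (i : ℕ) (t : ℤ), t ≤ m →
    ((isValley P i ∧ ht P (i + 1) = t) ↔ (isValley Q i ∧ ht Q (i + 1) = t))

/-- A multichain of Dyck paths of type `V` from `a` to `s`: it has length
`h = hv(a)` and for every `j ∈ [h]` its `(j-1)`-st and `j`-th members have the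
same valleys at every height at most `h - j`.  (The function `σ` is frozen from
index `h` on, so that such multichains are counted correctly.) -/
def IsVChain (a s : BinPath) (σ : ℕ → BinPath) : Prop :=
  σ 0 = a ∧ (∀ j, hvNat a ≤ j → σ j = s) ∧ (∀ j, IsDyck (σ j)) ∧
  (∀ j < hvNat a, pathLe (σ j) (σ (j + 1))) ∧
  (∀ j, 1 ≤ j → j ≤ hvNat a →
    sameValleysUpTo (σ (j - 1)) (σ j) ((hvNat a : ℤ) - (j : ℤ)))

/-- `V(a,s)`: the number of `a`–`s` multichains of type `V`. -/
noncomputable def VPath (a s : BinPath) : ℕ :=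
  Set.ncard {σ : ℕ → BinPath | IsVChain a s σ}

/-- `ζ^k(P,Q)`: the number of `P`–`Q` multichains of length `k`. -/
noncomputable def zetaPow (k : ℕ) (P Q : BinPath) : ℕ :=
  Set.ncard {c : ℕ → BinPath |
    c 0 = P ∧ (∀ i, k ≤ i → c i = Q) ∧ ∀ i < k, pathLe (c i) (c (i + 1))}

/-- The join of two paths of the same length (pointwise max of heights). -/
def pathSup (P Q : BinPath) : BinPath :=
  List.ofFn (fun i : Fin P.length =>
    decide (max (ht P i.1) (ht Q i.1) < max (ht P (i.1 + 1)) (ht Q (i.1 + 1))))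

/-- The meet of two paths of the same length (pointwise min of heights). -/
def pathInf (P Q : BinPath) : BinPath :=
  List.ofFn (fun i : Fin P.length =>
    decide (min (ht P i.1) (ht Q i.1) < min (ht P (i.1 + 1)) (ht Q (i.1 + 1))))

/-- `Q` covers `P` in the lattice of binary paths. -/
def pathCovBy (P Q : BinPath) : Prop :=
  pathLt P Q ∧ ∀ R : BinPath, pathLt P R → pathLt R Q → False

/-- `l(P,Q) = (1/2)·Σᵢ (hᵢ(Q) − hᵢ(P))`. -/
def lpq (P Q : BinPath) : ℕ :=
  ((∑ i ∈ Finset.range P.length, (ht Q (i + 1) - ht P (i + 1))) / 2).toNat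

/-- Convolution in the incidence algebra of the lattice of binary paths. -/
noncomputable def conv (F G : BinPath → BinPath → ℤ) : BinPath → BinPath → ℤ :=
  fun P Q => ∑ᶠ (R : BinPath) (_ : pathLe P R ∧ pathLe R Q), F P R * G R Q

/-- The delta function of the incidence algebra. -/
def deltaFun : BinPath → BinPath → ℤ := fun P Q => if P = Q then 1 else 0

/-- `μ^k`: the `k`-th convolution power of `μ` (`μ^0` is the delta function). -/
noncomputable def muPow (mu : BinPath → BinPath → ℤ) (k : ℕ) : BinPath → BinPath → ℤ :=
  (conv mu)^[k] deltaFun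

/-! ### Heights and downstep counts -/

/-- The number of downsteps among the first `x` steps of `P`. -/
def downCount (P : BinPath) (x : ℕ) : ℕ := (P.take x).count false

theorem ht_zero (P : BinPath) : ht P 0 = 0 := by simp [ht]

theorem ht_nil (k : ℕ) : ht [] k = 0 := by simp [ht]

theorem ht_cons_succ (b : Bool) (P : BinPath) (k : ℕ) :
    ht (b :: P) (k + 1) = (if b then 1 else -1) + ht P k := by simp [ht]

theorem ht_append (P Q : BinPath) (k : ℕ) :
    ht (P ++ Q) k = ht P k + ht Q (k - P.length) := by
  simp [ht, List.take_append]

theorem ht_take (P : BinPath) (m k : ℕ) : ht (P.take m) k = ht P (min k m) := by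
  simp [ht, List.take_take]

theorem ht_drop (P : BinPath) (m k : ℕ) : ht (P.drop m) k = ht P (m + k) - ht P m := by
  simp [ht, List.take_add]

theorem ht_min_length (P : BinPath) (k : ℕ) : ht P (min k P.length) = ht P k := by
  rw [← ht_take, List.take_length]

theorem ht_of_length_le {P : BinPath} {k : ℕ} (h : P.length ≤ k) : ht P k = ht P P.length := by
  rw [← ht_min_length P k, min_eq_right h]

theorem downCount_zero (P : BinPath) : downCount P 0 = 0 := by simp [downCount]

theorem downCount_succ {P : BinPath} {x : ℕ} (hx : x < P.length) :
    downCount P (x + 1) = downCount P x + if P.getD x true then 0 else 1 := by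
  rw [downCount, downCount, List.take_add_one]
  cases h : P[x] <;> simp [hx, h]

theorem downCount_le (P : BinPath) (x : ℕ) : downCount P x ≤ x :=
  (List.count_le_length).trans (by simp)

theorem downCount_le_succ {P : BinPath} {x : ℕ} (hx : x < P.length) :
    downCount P x ≤ downCount P (x + 1) := by
  rw [downCount_succ hx]; omega

theorem downCount_succ_le {P : BinPath} {x : ℕ} (hx : x < P.length) :
    downCount P (x + 1) ≤ downCount P x + 1 := by
  rw [downCount_succ hx]; split <;> omega

theorem ht_eq_downCount {P : BinPath} {x : ℕ} (hx : x ≤ P.length) :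
    ht P x = x - 2 * (downCount P x : ℤ) := by
  induction P generalizing x with
  | nil => simp at hx; simp [hx, ht, downCount]
  | cons b P ih =>
    cases x with
    | zero => simp [ht, downCount]
    | succ x =>
      rw [ht_cons_succ, ih (by simpa using hx)]
      cases b <;> simp [downCount] <;> ring

theorem ht_succ {P : BinPath} {x : ℕ} (hx : x < P.length) :
    ht P (x + 1) = ht P x + if P.getD x true then 1 else -1 := by
  rw [ht_eq_downCount hx, ht_eq_downCount hx.le, downCount_succ hx]
  split <;> push_cast <;> ring

theorem pathLe_iff {P Q : BinPath} {N : ℕ} (hP : P.length = N) (hQ : Q.length = N) :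
    pathLe P Q ↔ ∀ x ≤ N, downCount Q x ≤ downCount P x := by
  constructor
  · rintro ⟨-, h⟩ x hx
    have := h x
    rw [ht_eq_downCount (hP ▸ hx), ht_eq_downCount (hQ ▸ hx)] at this
    omega
  · intro h
    refine ⟨hP.trans hQ.symm, fun k => ?_⟩
    rw [← ht_min_length P, ← ht_min_length Q, hP, hQ, ht_eq_downCount (by omega),
      ht_eq_downCount (by omega)]
    have := h (min k N) (by omega)
    omega

theorem pathLe_refl (P : BinPath) : pathLe P P := ⟨rfl, fun _ => le_rfl⟩

theorem pathLe_trans {P Q R : BinPath} (h : pathLe P Q) (h' : pathLe Q R) : pathLe P R :=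
  ⟨h.1.trans h'.1, fun k => (h.2 k).trans (h'.2 k)⟩

theorem eq_of_ht_eq {P Q : BinPath} (hl : P.length = Q.length) (h : ∀ k, ht P k = ht Q k) :
    P = Q := by
  induction P generalizing Q with
  | nil => exact (List.length_eq_zero_iff.1 hl.symm).symm
  | cons b P ih =>
    cases Q with
    | nil => simp at hl
    | cons c Q =>
      have h1 := h 1
      have hbc : b = c := by
        cases b <;> cases c <;> simp [ht] at h1 ⊢
      subst hbc
      rw [ih (by simpa using hl) fun k => by have := h (k + 1); simpa [ht_cons_succ] using this]

theorem eq_of_downCount_eq {P Q : BinPath} {N : ℕ} (hP : P.length = N) (hQ : Q.length = N)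
    (h : ∀ x ≤ N, downCount P x = downCount Q x) : P = Q := by
  have h₁ := (pathLe_iff hP hQ).2 fun x hx => (h x hx).ge
  have h₂ := (pathLe_iff hQ hP).2 fun x hx => (h x hx).le
  exact eq_of_ht_eq h₁.1 fun k => le_antisymm (h₁.2 k) (h₂.2 k)

theorem length_maxPath (N : ℕ) : (maxPath N).length = N := by simp [maxPath]

theorem downCount_maxPath (N x : ℕ) : downCount (maxPath N) x = 0 := by
  simp [downCount, maxPath, List.count_replicate]

theorem pathLe_maxPath {P : BinPath} {N : ℕ} (hP : P.length = N) : pathLe P (maxPath N) :=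
  (pathLe_iff hP (length_maxPath N)).2 fun x _ => by simp [downCount_maxPath]

/-- The path of length `N` whose downstep counts are prescribed by `E`. -/
def pathOf (N : ℕ) (E : ℕ → ℕ) : BinPath :=
  List.ofFn fun x : Fin N => decide (E (x + 1) = E x)

theorem length_pathOf (N : ℕ) (E : ℕ → ℕ) : (pathOf N E).length = N := by simp [pathOf]

theorem downCount_pathOf {N : ℕ} {E : ℕ → ℕ} (h0 : E 0 = 0)
    (h1 : ∀ x < N, E x ≤ E (x + 1)) (h2 : ∀ x < N, E (x + 1) ≤ E x + 1) {x : ℕ} (hx : x ≤ N) :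
    downCount (pathOf N E) x = E x := by
  induction x with
  | zero => rw [downCount_zero, h0]
  | succ x ih =>
    have hx' : x < N := hx
    rw [downCount_succ (by rw [length_pathOf]; exact hx'), ih hx'.le]
    have := h1 x hx'
    have := h2 x hx'
    rw [List.getD_eq_getElem _ _ (by rw [length_pathOf]; exact hx')]
    simp only [pathOf, List.getElem_ofFn, decide_eq_true_eq]
    split <;> omega

/-! ### Filling -/

theorem length_fill (P : BinPath) : (fill P).length = P.length := by simp [fill]

theorem getD_fill {P : BinPath} {x : ℕ} (hx : x < P.length) :
    (fill P).getD x true = if P.getD x true then P.getD (x - 1) true else P.getD (x + 1) true := by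
  rw [List.getD_eq_getElem _ _ (by rw [length_fill]; exact hx), List.getD_eq_getElem P _ hx]
  simp [fill]

/-- `1` if the point with index `x` is a valley of `P`, and `0` otherwise. -/
def valleyInd (P : BinPath) (x : ℕ) : ℕ :=
  if 1 ≤ x ∧ P.getD (x - 1) true = false ∧ P.getD x true = true then 1 else 0

theorem downCount_fill {P : BinPath} {x : ℕ} (hx : x ≤ P.length) :
    downCount (fill P) x + valleyInd P x = downCount P x := by
  induction x with
  | zero => simp [downCount_zero, valleyInd]
  | succ x ih =>
    have hx' : x < P.length := hx
    have ih := ih hx'.le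
    rw [downCount_succ (by rw [length_fill]; exact hx'), downCount_succ hx', getD_fill hx']
    unfold valleyInd at *
    rcases x with _ | x
    · cases P.getD 0 true <;> cases P.getD 1 true <;> simp_all
    · simp only [Nat.add_sub_cancel] at *
      generalize P.getD x true = p at *
      generalize P.getD (x + 1) true = q at *
      generalize P.getD (x + 1 + 1) true = r at *
      cases p <;> cases q <;> cases r <;> simp at ih ⊢ <;> omega

theorem le_le_fill_iff {c c' : BinPath} {N : ℕ} (hc : c.length = N) (hc' : c'.length = N) :
    (pathLe c c' ∧ pathLe c' (fill c)) ↔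
      ((∀ x ≤ N, downCount c' x ≤ downCount c x) ∧
        (∀ x < N, downCount c x ≤ downCount c' (x + 1)) ∧
        ∀ x < N, downCount c (x + 1) ≤ downCount c' x + 1) := by
  rw [pathLe_iff hc hc', pathLe_iff hc' ((length_fill c).trans hc)]
  constructor
  · rintro ⟨h1, h2⟩
    refine ⟨h1, fun x hx => ?_, fun x hx => ?_⟩
    · have a1 := h2 (x + 1) hx
      have a2 := downCount_fill (P := c) (x := x + 1) (by omega)
      have a3 := downCount_succ (P := c) (x := x) (by omega)
      unfold valleyInd at a2
      simp only [Nat.add_sub_cancel] at a2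
      generalize c.getD x true = p at *
      generalize c.getD (x + 1) true = q at *
      cases p <;> cases q <;> simp at a2 a3 <;> omega
    · have a1 := h2 x hx.le
      have a2 := downCount_fill (P := c) (x := x) (by omega)
      have a3 := downCount_succ (P := c) (x := x) (by omega)
      unfold valleyInd at a2
      generalize c.getD x true = p at *
      generalize c.getD (x - 1) true = q at *
      cases p <;> cases q <;> simp at a2 a3 <;> (try split at a2) <;> omega
  · rintro ⟨h1, h2, h3⟩
    refine ⟨h1, fun x hx => ?_⟩
    have a2 := downCount_fill (P := c) (x := x) (by omega)
    rcases x with _ | x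
    · simp [downCount_zero] at a2 ⊢
    have a3 := downCount_succ (P := c) (x := x) (by omega)
    have b2 := h2 x hx
    have b3 := h3 x hx
    unfold valleyInd at a2
    by_cases hx1 : x + 1 < N
    · have a4 := downCount_succ (P := c) (x := x + 1) (by omega)
      have b4 := h3 (x + 1) hx1
      simp only [Nat.add_sub_cancel] at *
      cases e1 : c.getD x true <;> cases e2 : c.getD (x + 1) true <;>
        simp only [e1, e2] at * <;> simp at * <;> omega
    · have e2 : c.getD (x + 1) true = true := List.getD_eq_default _ _ (by omega)
      simp only [Nat.add_sub_cancel] at *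
      cases e1 : c.getD x true <;>
        simp only [e1, e2] at * <;> simp at * <;> omega

theorem le_fill (P : BinPath) : pathLe P (fill P) :=
  (pathLe_iff rfl (length_fill P)).2 fun x hx => by have := downCount_fill hx; omega

/-! ### Chains with small intervals and their slanted slices -/

/-- `c'` arises from `c` by turning some of the valleys of `c` into peaks. -/
def FillStep (N : ℕ) (c c' : BinPath) : Prop :=
  (∀ x ≤ N, downCount c' x ≤ downCount c x) ∧
    (∀ x < N, downCount c x ≤ downCount c' (x + 1)) ∧
    ∀ x < N, downCount c (x + 1) ≤ downCount c' x + 1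

theorem fillStep_fill {P : BinPath} {N : ℕ} (hP : P.length = N) : FillStep N P (fill P) :=
  (le_le_fill_iff hP ((length_fill P).trans hP)).1 ⟨le_fill P, pathLe_refl _⟩

theorem length_iterate_fill (P : BinPath) (t : ℕ) : (fill^[t] P).length = P.length := by
  induction t with
  | zero => rfl
  | succ t ih => rw [Function.iterate_succ_apply', length_fill, ih]

theorem downCount_iterate_fill_le {P : BinPath} {N : ℕ} (hP : P.length = N)
    (hlow : ∀ x ≤ N, downCount P x ≤ (x + 1) / 2) (t : ℕ) {x : ℕ} (hx : x ≤ N) :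
    downCount (fill^[t] P) x ≤ (x + 1 - t) / 2 := by
  induction t generalizing x with
  | zero => simpa using hlow x hx
  | succ t ih =>
    rw [Function.iterate_succ_apply']
    have hl : (fill^[t] P).length = N := (length_iterate_fill P t).trans hP
    generalize fill^[t] P = c at *
    have a2 := downCount_fill (P := c) (x := x) (by omega)
    rcases x with _ | x
    · simp [downCount_zero]
    have a3 := downCount_succ (P := c) (x := x) (by omega)
    have b1 := ih (x := x) (by omega)
    have b2 := ih hx
    unfold valleyInd at a2
    simp only [Nat.add_sub_cancel] at *
    by_cases hx1 : x + 1 < N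
    · have a4 := downCount_succ (P := c) (x := x + 1) (by omega)
      have b3 := ih (x := x + 1 + 1) (by omega)
      generalize c.getD x true = p at *
      generalize c.getD (x + 1) true = q at *
      cases p <;> cases q <;> simp at * <;> omega
    · have e2 : c.getD (x + 1) true = true := List.getD_eq_default _ _ (by omega)
      rw [e2] at a2
      generalize c.getD x true = p at *
      cases p <;> simp at * <;> omega

theorem one_le_downCount_of_fillStep {c : ℕ → BinPath} {N k : ℕ} (h0 : downCount (c 0) 1 = 1)
    (hs : ∀ i < k, FillStep N (c i) (c (i + 1))) {t : ℕ} (ht : t ≤ k) (htN : t < N) :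
    1 ≤ downCount (c t) (t + 1) := by
  induction t with
  | zero => simp [h0]
  | succ t ih => exact (ih (by omega) (by omega)).trans ((hs t ht).2.1 (t + 1) htN)

theorem degree_eq_length {P : BinPath} {N : ℕ} (hP : P.length = N)
    (hlow : ∀ x ≤ N, downCount P x ≤ (x + 1) / 2) (h1 : downCount P 1 = 1) :
    degree P = N := by
  apply le_antisymm
  · refine Nat.sInf_le ?_
    refine eq_of_downCount_eq ((length_iterate_fill P N).trans hP)
      ((length_maxPath _).trans hP) fun x hx => ?_
    have := downCount_iterate_fill_le hP hlow N hx
    rw [downCount_maxPath]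
    omega
  · refine le_csInf ⟨N, ?_⟩ fun k hk => ?_
    · refine eq_of_downCount_eq ((length_iterate_fill P N).trans hP)
        ((length_maxPath _).trans hP) fun x hx => ?_
      have := downCount_iterate_fill_le hP hlow N hx
      rw [downCount_maxPath]
      omega
    · by_contra! hkN
      have := one_le_downCount_of_fillStep (c := fun t => fill^[t] P) (N := N) (k := k) h1
        (fun i _ => by
          simp only [Function.iterate_succ_apply']
          exact fillStep_fill ((length_iterate_fill P i).trans hP)) le_rfl hkN
      simp only [Set.mem_ofPred_eq] at hk
      simp [hk, downCount_maxPath] at this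

/-- Multichains with small intervals from `P` reaching the maximum path after `N` steps. -/
def fillChains (P : BinPath) (N : ℕ) : Set (ℕ → BinPath) :=
  {c | (∀ t, (c t).length = N) ∧ c 0 = P ∧ (∀ t, N ≤ t → c t = maxPath N) ∧
    ∀ t, FillStep N (c t) (c (t + 1))}

/-- Decreasing families of paths above `P`, starting from the maximum path, whose `r`-th member
does not differ from `P` at low heights (in terms of downstep counts). -/
def levelFamilies (P : BinPath) (N : ℕ) : Set (ℕ → BinPath) :=
  {q | (∀ r, (q r).length = N) ∧ q 0 = maxPath N ∧ (∀ r, pathLe (q (r + 1)) (q r)) ∧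
    (∀ r, pathLe P (q r)) ∧
    ∀ x ≤ N, ∀ i, downCount (q (x - 2 * i)) x ≤ i → downCount P x ≤ i}

theorem fPath_eq_ncard_fillChains {P : BinPath} {N : ℕ} (hP : P.length = N)
    (hlow : ∀ x ≤ N, downCount P x ≤ (x + 1) / 2) (h1 : downCount P 1 = 1) :
    fPath P = (fillChains P N).ncard := by
  unfold fPath
  rw [degree_eq_length hP hlow h1, hP]
  congr 1
  ext c
  simp only [Set.mem_ofPred_eq, fillChains]
  constructor
  · rintro ⟨h0, hN, hc⟩
    have hl : ∀ t, (c t).length = N := by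
      intro t
      by_cases ht : N ≤ t
      · rw [hN t ht, length_maxPath]
      · push Not at ht
        induction t with
        | zero => rw [h0, hP]
        | succ t ih => rw [← (hc t (by omega)).1.1.1, ih (by omega)]
    refine ⟨hl, h0, hN, fun t => ?_⟩
    by_cases ht : N ≤ t
    · rw [hN t ht, hN (t + 1) (by omega)]
      simp [FillStep, downCount_maxPath]
    · exact (le_le_fill_iff (hl t) (hl (t + 1))).1 ⟨(hc t (by omega)).1.1, (hc t (by omega)).2⟩
  · rintro ⟨hl, h0, hN, hs⟩
    refine ⟨h0, hN, fun i hi => ?_⟩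
    obtain ⟨h2, h3⟩ := (le_le_fill_iff (hl i) (hl (i + 1))).2 (hs i)
    refine ⟨⟨h2, fun he => ?_⟩, h3⟩
    have hpos := one_le_downCount_of_fillStep (k := N) (by rw [h0, h1]) (fun j _ => hs j) hi.le hi
    have hzero : ∀ j, j ≤ N → downCount (c (N - j)) (N - j) = 0 := by
      intro j
      induction j with
      | zero => intro _; rw [Nat.sub_zero, hN N le_rfl, downCount_maxPath]
      | succ j ih =>
        intro hj
        have := (hs (N - (j + 1))).2.1 (N - (j + 1)) (by omega)
        rw [show N - (j + 1) + 1 = N - j by omega, ih (by omega)] at this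
        omega
    have := hzero (N - (i + 1)) (by omega)
    rw [show N - (N - (i + 1)) = i + 1 by omega, ← he] at this
    omega

/-- The family of slanted slices of `c`. -/
noncomputable def slant (N : ℕ) (c : ℕ → BinPath) (r : ℕ) : BinPath :=
  pathOf N fun x => sInf {i | downCount (c (x - 2 * i - r)) x ≤ i}

theorem length_slant (N : ℕ) (c : ℕ → BinPath) (r : ℕ) : (slant N c r).length = N :=
  length_pathOf _ _

/-- The slanted slices of `c` are given by paths. -/
def Slantable (N : ℕ) (c : ℕ → BinPath) : Prop :=
  (∀ r i, ∀ x < N, downCount (c (x + 1 - 2 * i - r)) (x + 1) ≤ i →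
    downCount (c (x - 2 * i - r)) x ≤ i) ∧
  ∀ r i, ∀ x < N, downCount (c (x - 2 * i - r)) x ≤ i →
    downCount (c (x + 1 - 2 * (i + 1) - r)) (x + 1) ≤ i + 1

theorem downCount_slant_le_iff {N : ℕ} {c : ℕ → BinPath} (hc : Slantable N c) {r x i : ℕ}
    (hx : x ≤ N) :
    downCount (slant N c r) x ≤ i ↔ downCount (c (x - 2 * i - r)) x ≤ i := by
  obtain ⟨h1, h2⟩ := hc
  have hmono : ∀ x ≤ N, ∀ i, downCount (c (x - 2 * i - r)) x ≤ i →
      downCount (c (x - 2 * (i + 1) - r)) x ≤ i + 1 := by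
    intro x hx i hi
    rcases x with _ | x
    · simp [downCount_zero]
    · exact h2 r i x hx (h1 r i x hx hi)
  have hmono' : ∀ x ≤ N, ∀ i j, i ≤ j → downCount (c (x - 2 * i - r)) x ≤ i →
      downCount (c (x - 2 * j - r)) x ≤ j := by
    intro x hx i j hij hi
    induction j, hij using Nat.le_induction with
    | base => exact hi
    | succ j _ ih => exact hmono x hx j ih
  have key : ∀ x ≤ N, ∀ i, sInf {i | downCount (c (x - 2 * i - r)) x ≤ i} ≤ i ↔
      downCount (c (x - 2 * i - r)) x ≤ i := by
    intro x hx i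
    constructor
    · intro h
      have := Nat.sInf_mem (s := {i | downCount (c (x - 2 * i - r)) x ≤ i})
        ⟨x, downCount_le _ _⟩
      exact hmono' x hx _ i h this
    · exact fun h => Nat.sInf_le h
  rw [slant, downCount_pathOf _ _ _ hx]
  · exact key x hx i
  · exact Nat.le_zero.1 ((key 0 (Nat.zero_le _) 0).2 (by simp [downCount_zero]))
  · intro y hy
    exact (key y hy.le _).2 (h1 r _ y hy ((key (y + 1) hy _).1 le_rfl))
  · intro y hy
    exact (key (y + 1) hy _).2 (h2 r _ y hy ((key y hy.le _).1 le_rfl))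

theorem slantable_of_mem_fillChains {P : BinPath} {N : ℕ} {c : ℕ → BinPath}
    (hc : c ∈ fillChains P N) : Slantable N c := by
  obtain ⟨hl, h0, hN, hs⟩ := hc
  constructor
  · intro r i x hx h
    by_cases hr : 2 * i + r ≤ x
    · rw [show x + 1 - 2 * i - r = x - 2 * i - r + 1 by omega] at h
      exact ((hs _).2.1 x hx).trans h
    · rw [show x + 1 - 2 * i - r = x - 2 * i - r by omega] at h
      exact (downCount_le_succ (by rw [hl]; exact hx)).trans h
  · intro r i x hx h
    by_cases hr : 2 * i + r + 1 ≤ x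
    · rw [show x - 2 * i - r = x + 1 - 2 * (i + 1) - r + 1 by omega] at h
      exact ((hs _).2.2 x hx).trans (by omega)
    · rw [show x - 2 * i - r = x + 1 - 2 * (i + 1) - r by omega] at h
      exact (downCount_succ_le (by rw [hl]; exact hx)).trans (by omega)

theorem downCount_levelFamilies_mono {P : BinPath} {N : ℕ} {q : ℕ → BinPath}
    (hq : q ∈ levelFamilies P N) {r s x : ℕ} (hx : x ≤ N) (hrs : r ≤ s) :
    downCount (q r) x ≤ downCount (q s) x := by
  induction s, hrs using Nat.le_induction with
  | base => exact le_rfl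
  | succ s _ ih => exact ih.trans ((pathLe_iff (hq.1 _) (hq.1 _)).1 (hq.2.2.1 s) x hx)

theorem downCount_fillChains_anti {P : BinPath} {N : ℕ} {c : ℕ → BinPath}
    (hc : c ∈ fillChains P N) {r s x : ℕ} (hx : x ≤ N) (hrs : r ≤ s) :
    downCount (c s) x ≤ downCount (c r) x := by
  induction s, hrs using Nat.le_induction with
  | base => exact le_rfl
  | succ s _ ih => exact ((hc.2.2.2 s).1 x hx).trans ih

theorem slantable_of_mem_levelFamilies {P : BinPath} {N : ℕ} {q : ℕ → BinPath}
    (hq : q ∈ levelFamilies P N) : Slantable N q := by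
  constructor
  · intro r i x hx h
    exact (downCount_levelFamilies_mono hq hx.le (by omega)).trans
      ((downCount_le_succ (by rw [hq.1]; exact hx)).trans h)
  · intro r i x hx h
    exact (downCount_levelFamilies_mono hq (s := x - 2 * i - r) hx (by omega)).trans
      ((downCount_succ_le (by rw [hq.1]; exact hx)).trans (by omega))

theorem slant_mem_levelFamilies {P : BinPath} {N : ℕ} (hP : P.length = N) {c : ℕ → BinPath}
    (hc : c ∈ fillChains P N) : slant N c ∈ levelFamilies P N := by
  have hS := slantable_of_mem_fillChains hc
  refine ⟨length_slant N c, ?_, fun r => ?_, fun r => ?_, fun x hx i h => ?_⟩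
  · refine eq_of_downCount_eq (length_slant N c 0) (length_maxPath N) fun x hx => ?_
    rw [downCount_maxPath]
    refine Nat.le_zero.1 ((downCount_slant_le_iff hS hx).2 ?_)
    have h : ∀ j, j ≤ N → downCount (c (N - j)) (N - j) = 0 := by
      intro j
      induction j with
      | zero => intro _; rw [Nat.sub_zero, hc.2.2.1 N le_rfl, downCount_maxPath]
      | succ j ih =>
        intro hj
        have := (hc.2.2.2 (N - (j + 1))).2.1 (N - (j + 1)) (by omega)
        rw [show N - (j + 1) + 1 = N - j by omega, ih (by omega)] at this
        omega
    have := h (N - x) (by omega)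
    rw [show N - (N - x) = x by omega] at this
    simp [this]
  · refine (pathLe_iff (length_slant ..) (length_slant ..)).2 fun x hx => ?_
    rw [downCount_slant_le_iff hS hx]
    exact (downCount_fillChains_anti hc hx (by omega)).trans
      ((downCount_slant_le_iff hS hx).1 (le_refl (downCount (slant N c (r + 1)) x)))
  · refine (pathLe_iff hP (length_slant ..)).2 fun x hx => ?_
    rw [downCount_slant_le_iff hS hx]
    exact (downCount_fillChains_anti hc hx (Nat.zero_le _)).trans (by rw [hc.2.1])
  · rw [downCount_slant_le_iff hS hx, Nat.sub_self, hc.2.1] at h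
    exact h

theorem slant_mem_fillChains {P : BinPath} {N : ℕ} (hP : P.length = N) {q : ℕ → BinPath}
    (hq : q ∈ levelFamilies P N) : slant N q ∈ fillChains P N := by
  have hS := slantable_of_mem_levelFamilies hq
  have hself : ∀ {t x : ℕ}, x ≤ N →
      downCount (q (x - 2 * downCount (slant N q t) x - t)) x ≤ downCount (slant N q t) x :=
    fun hx => (downCount_slant_le_iff hS hx).1 le_rfl
  refine ⟨length_slant N q, ?_, fun t ht => ?_, fun t => ⟨fun x hx => ?_, fun x hx => ?_,
    fun x hx => ?_⟩⟩
  · refine eq_of_downCount_eq (length_slant ..) hP fun x hx => eq_of_forall_ge_iff fun i => ?_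
    rw [downCount_slant_le_iff hS hx, Nat.sub_zero]
    exact ⟨hq.2.2.2.2 x hx i,
      ((pathLe_iff hP (hq.1 _)).1 (hq.2.2.2.1 _) x hx).trans⟩
  · refine eq_of_downCount_eq (length_slant ..) (length_maxPath N) fun x hx => ?_
    rw [downCount_maxPath]
    refine Nat.le_zero.1 ((downCount_slant_le_iff hS hx).2 ?_)
    rw [show x - 2 * 0 - t = 0 by omega, hq.2.1, downCount_maxPath]
  · rw [downCount_slant_le_iff hS hx]
    exact (downCount_levelFamilies_mono hq hx (by omega)).trans (hself hx)
  · rw [downCount_slant_le_iff hS hx.le]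
    refine le_trans ?_ (hself (t := t + 1) hx)
    rw [show ∀ d, x + 1 - 2 * d - (t + 1) = x - 2 * d - t by intro d; omega]
    exact downCount_le_succ (by rw [hq.1]; exact hx)
  · rw [downCount_slant_le_iff hS hx]
    have := hself (t := t + 1) hx.le
    rw [show ∀ d, x + 1 - 2 * (d + 1) - t = x - 2 * d - (t + 1) by intro d; omega]
    exact (downCount_succ_le (by rw [hq.1]; exact hx)).trans (by omega)

theorem slant_slant_of_mem_fillChains {P : BinPath} {N : ℕ} (hP : P.length = N)
    {c : ℕ → BinPath} (hc : c ∈ fillChains P N) : slant N (slant N c) = c := by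
  have hq := slant_mem_levelFamilies hP hc
  have hS := slantable_of_mem_fillChains hc
  have hS' := slantable_of_mem_levelFamilies hq
  funext t
  refine eq_of_downCount_eq (length_slant ..) (hc.1 t) fun x hx => eq_of_forall_ge_iff fun i => ?_
  rw [downCount_slant_le_iff hS' hx, downCount_slant_le_iff hS hx]
  by_cases h : t ≤ x - 2 * i
  · rw [show x - 2 * i - (x - 2 * i - t) = t by omega]
  · rw [show x - 2 * i - (x - 2 * i - t) = x - 2 * i by omega]
    have h1 : downCount (c (x - 2 * i)) x ≤ i := by
      have := hq.2.1
      have h2 : downCount (slant N c 0) x ≤ i := by rw [this, downCount_maxPath]; omega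
      simpa using (downCount_slant_le_iff hS hx).1 h2
    exact iff_of_true h1 ((downCount_fillChains_anti hc hx (by omega)).trans h1)

theorem slant_slant_of_mem_levelFamilies {P : BinPath} {N : ℕ} (hP : P.length = N)
    {q : ℕ → BinPath} (hq : q ∈ levelFamilies P N) : slant N (slant N q) = q := by
  have hc := slant_mem_fillChains hP hq
  have hS := slantable_of_mem_levelFamilies hq
  have hS' := slantable_of_mem_fillChains hc
  funext t
  refine eq_of_downCount_eq (length_slant ..) (hq.1 t) fun x hx => eq_of_forall_ge_iff fun i => ?_
  rw [downCount_slant_le_iff hS' hx, downCount_slant_le_iff hS hx]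
  by_cases h : t ≤ x - 2 * i
  · rw [show x - 2 * i - (x - 2 * i - t) = t by omega]
  · rw [show x - 2 * i - (x - 2 * i - t) = x - 2 * i by omega]
    refine ⟨fun h1 => ?_, (downCount_levelFamilies_mono hq hx (by omega)).trans⟩
    exact ((pathLe_iff hP (hq.1 _)).1 (hq.2.2.2.1 _) x hx).trans (hq.2.2.2.2 x hx i h1)

/-- Slanted slices exchange chains with small intervals and level families. -/
noncomputable def fillChainsEquiv {P : BinPath} {N : ℕ} (hP : P.length = N) :
    fillChains P N ≃ levelFamilies P N where
  toFun c := ⟨slant N c, slant_mem_levelFamilies hP c.2⟩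
  invFun q := ⟨slant N q, slant_mem_fillChains hP q.2⟩
  left_inv c := Subtype.ext (slant_slant_of_mem_fillChains hP c.2)
  right_inv q := Subtype.ext (slant_slant_of_mem_levelFamilies hP q.2)

/-! ### Families of paths pinned at low heights -/

/-- `Q` agrees with `P` wherever the height of `P` is at most `m`. -/
def PinnedUpTo (P Q : BinPath) (m : ℤ) : Prop := ∀ x, ht P x ≤ m → ht Q x = ht P x

/-- Decreasing families of paths above `P`, the `r`-th of which agrees with `P` wherever the
height of `P` is at most `r`. -/
def pinnedFamilies (P : BinPath) : Set (ℕ → BinPath) :=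
  {Q | ∀ r, pathLe P (Q r) ∧ pathLe (Q (r + 1)) (Q r) ∧ PinnedUpTo P (Q r) r}

theorem pinnedFamilies_le {P : BinPath} {Q : ℕ → BinPath} (hQ : Q ∈ pinnedFamilies P) (r : ℕ) :
    pathLe P (Q r) := (hQ r).1

theorem length_of_mem_pinnedFamilies {P : BinPath} {Q : ℕ → BinPath}
    (hQ : Q ∈ pinnedFamilies P) (r : ℕ) : (Q r).length = P.length := (hQ r).1.1.symm

theorem pinnedUpTo_iff {P Q : BinPath} {N : ℕ} (hP : P.length = N) (hQ : Q.length = N) {m : ℤ} :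
    PinnedUpTo P Q m ↔ ∀ x ≤ N, ht P x ≤ m → downCount Q x = downCount P x := by
  constructor
  · intro h x hx hm
    have := h x hm
    rw [ht_eq_downCount (by omega), ht_eq_downCount (by omega)] at this
    omega
  · intro h x hm
    rw [← ht_min_length P] at hm
    rw [← ht_min_length P, ← ht_min_length Q, hP, hQ, ht_eq_downCount (by omega),
      ht_eq_downCount (by omega), h _ (by omega) (hP ▸ hm)]

theorem downCount_cons_succ (b : Bool) (P : BinPath) (x : ℕ) :
    downCount (b :: P) (x + 1) = downCount P x + if b then 0 else 1 := by
  cases b <;> simp [downCount]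

theorem eq_cons_tail_of_downCount_pos {P : BinPath} (h : 0 < downCount P 1) :
    P = false :: P.tail := by
  rcases P with _ | ⟨b, P⟩
  · simp [downCount] at h
  · cases b
    · rfl
    · simp [downCount] at h

theorem eq_cons_tail_of_ht_one {P : BinPath} (h : ht P 1 = 1) : P = true :: P.tail := by
  rcases P with _ | ⟨b, P⟩
  · simp [ht] at h
  · cases b
    · simp [ht] at h
    · rfl

theorem mem_pinnedFamilies_of_mem_levelFamilies {U : BinPath} (hU : ∀ k, 0 ≤ ht U k)
    {q : ℕ → BinPath} (hq : q ∈ levelFamilies (false :: U) (U.length + 1)) :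
    (∀ r, q (r + 1) = false :: (q (r + 1)).tail) ∧
      (fun r => (q (r + 1)).tail) ∈ pinnedFamilies U := by
  have hhead : ∀ r, q (r + 1) = false :: (q (r + 1)).tail := by
    intro r
    apply eq_cons_tail_of_downCount_pos
    refine lt_of_lt_of_le ?_ (downCount_levelFamilies_mono hq (r := 1) (by omega) (by omega))
    by_contra h
    have := hq.2.2.2.2 1 (by omega) 0 (by simpa using h)
    simp [downCount] at this
  refine ⟨hhead, ?_⟩
  have hl : ∀ r, (q (r + 1)).tail.length = U.length := fun r => by
    rw [List.length_tail, hq.1]; rfl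
  have hdc : ∀ r x, downCount (q (r + 1)) (x + 1) = downCount (q (r + 1)).tail x + 1 := by
    intro r x
    conv_lhs => rw [hhead r]
    simp [downCount_cons_succ]
  have hle : ∀ r, pathLe U (q (r + 1)).tail := by
    intro r
    refine (pathLe_iff rfl (hl r)).2 fun x hx => ?_
    have := (pathLe_iff (by simp) (hq.1 (r + 1))).1 (hq.2.2.2.1 (r + 1)) (x + 1) (by omega)
    rw [hdc, downCount_cons_succ] at this
    simpa using this
  refine fun r => ⟨hle r, ?_, ?_⟩
  · refine (pathLe_iff (hl (r + 1)) (hl r)).2 fun x hx => ?_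
    have := (pathLe_iff (hq.1 _) (hq.1 _)).1 (hq.2.2.1 (r + 1)) (x + 1) (by omega)
    rw [hdc, hdc] at this
    omega
  · refine (pinnedUpTo_iff rfl (hl r)).2 fun x hx hm => ?_
    refine le_antisymm ((pathLe_iff rfl (hl r)).1 (hle r) x hx) ?_
    have h0 := hU x
    rw [ht_eq_downCount hx] at h0 hm
    have h1 : ¬ downCount (q (x + 1 - 2 * downCount U x)) (x + 1) ≤ downCount U x := by
      intro h
      have := hq.2.2.2.2 (x + 1) (by omega) _ h
      rw [downCount_cons_succ] at this
      simp at this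
    have h2 := downCount_levelFamilies_mono hq (r := x + 1 - 2 * downCount U x) (s := r + 1)
      (x := x + 1) (by omega) (by omega)
    rw [hdc] at h2
    omega

theorem mem_levelFamilies_of_mem_pinnedFamilies {U : BinPath}
    (hU : ∀ k, 0 ≤ ht U k) {Q : ℕ → BinPath} (hQ : Q ∈ pinnedFamilies U) :
    (fun r => Nat.casesOn r (maxPath (U.length + 1)) fun r => false :: Q r : ℕ → BinPath) ∈
      levelFamilies (false :: U) (U.length + 1) := by
  have hl := length_of_mem_pinnedFamilies hQ
  refine ⟨fun r => ?_, rfl, fun r => ?_, fun r => ?_, fun x hx i h => ?_⟩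
  · rcases r with _ | r
    · exact length_maxPath _
    · simp [hl]
  · rcases r with _ | r
    · exact pathLe_maxPath (by simp [hl])
    · refine (pathLe_iff (N := U.length + 1) (by simp [hl]) (by simp [hl])).2 fun x hx => ?_
      rcases x with _ | x
      · simp [downCount_zero]
      · have := (pathLe_iff (hl _) (hl _)).1 (hQ r).2.1 x (by omega)
        simpa [downCount_cons_succ] using this
  · rcases r with _ | r
    · exact pathLe_maxPath (by simp)
    · refine (pathLe_iff (N := U.length + 1) (by simp) (by simp [hl])).2 fun x hx => ?_
      rcases x with _ | x
      · simp [downCount_zero]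
      · have := (pathLe_iff rfl (hl _)).1 (hQ r).1 x (by omega)
        simpa [downCount_cons_succ] using this
  · rcases x with _ | x
    · simp [downCount_zero]
    rw [downCount_cons_succ]
    have hb := hU x
    rw [ht_eq_downCount (by omega)] at hb
    rcases hr : x + 1 - 2 * i with _ | r
    · simp only [Bool.false_eq_true, if_false]
      omega
    · simp only [hr, downCount_cons_succ, Bool.false_eq_true, if_false] at h ⊢
      by_contra hcon
      have := (pinnedUpTo_iff rfl (hl r)).1 (hQ r).2.2 x (by omega)
        (by rw [ht_eq_downCount (by omega)]; omega)
      omega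

/-- Removing the initial downstep turns level families into pinned families. -/
def levelFamiliesEquiv {U : BinPath} (hU : ∀ k, 0 ≤ ht U k) :
    levelFamilies (false :: U) (U.length + 1) ≃ pinnedFamilies U where
  toFun q := ⟨fun r => ((q : ℕ → BinPath) (r + 1)).tail,
    (mem_pinnedFamilies_of_mem_levelFamilies hU q.2).2⟩
  invFun Q := ⟨_, mem_levelFamilies_of_mem_pinnedFamilies hU Q.2⟩
  left_inv q := by
    ext1
    funext r
    rcases r with _ | r
    · exact q.2.2.1.symm
    · exact ((mem_pinnedFamilies_of_mem_levelFamilies hU q.2).1 r).symm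
  right_inv Q := rfl

theorem exists_isValley_of_lt {P Q : BinPath} (hl : P.length = Q.length) {x : ℕ}
    (h : ht P x < ht Q x) :
    ∃ i, isValley P i ∧ ht P (i + 1) ≤ ht P x ∧ ht P (i + 1) < ht Q (i + 1) := by
  have main : ∀ n : ℕ, ∀ x ≤ P.length, ht P x < ht Q x → ht P x + P.length < n →
      ∃ i, isValley P i ∧ ht P (i + 1) ≤ ht P x ∧ ht P (i + 1) < ht Q (i + 1) := by
    intro n
    induction n with
    | zero =>
      intro x hx _ hn
      rw [ht_eq_downCount hx] at hn
      have := downCount_le P x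
      push_cast at hn
      omega
    | succ n ih =>
      intro x hx hlt hn
      by_cases hd : P.getD x true = false
      · have hxl : x < P.length := by
          by_contra hc
          rw [List.getD_eq_default _ _ (by omega)] at hd
          simp at hd
        have e1 := ht_succ hxl
        have e2 := ht_succ (hl ▸ hxl)
        rw [hd] at e1
        simp only [Bool.false_eq_true, if_false] at e1
        obtain ⟨i, hi, h1, h2⟩ := ih (x + 1) hxl (by split at e2 <;> omega) (by push_cast at hn; omega)
        exact ⟨i, hi, by omega, h2⟩
      · rcases x with _ | y
        · simp [ht_zero] at hlt
        have e1 := ht_succ (P := P) (x := y) hx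
        by_cases hu : P.getD y true = true
        · have e2 := ht_succ (P := Q) (x := y) (by omega)
          rw [hu] at e1
          simp only [if_true] at e1
          obtain ⟨i, hi, h1, h2⟩ := ih y (by omega) (by split at e2 <;> omega)
            (by push_cast at hn; omega)
          exact ⟨i, hi, by omega, h2⟩
        · exact ⟨y, ⟨hx, by simpa using hu, by simpa using hd⟩, le_rfl, hlt⟩
  rw [← ht_min_length P, ← ht_min_length Q, ← hl] at h
  obtain ⟨i, h1, h2, h3⟩ := main _ _ (by omega) h
    (show _ < (((ht P (min x P.length) + P.length).toNat + 1 : ℕ) : ℤ) by omega)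
  exact ⟨i, h1, by rwa [ht_min_length] at h2, h3⟩

theorem isValley_iff {P : BinPath} {i : ℕ} :
    isValley P i ↔ i < P.length ∧ ht P i = ht P (i + 1) + 1 ∧
      (i + 1 < P.length → ht P (i + 2) = ht P (i + 1) + 1) := by
  unfold isValley
  by_cases hi : i < P.length
  · have e1 := ht_succ hi
    by_cases hi' : i + 1 < P.length
    · have e2 := ht_succ hi'
      simp only [hi, hi', true_and, true_imp_iff]
      split at e1 <;> split at e2 <;> simp_all <;> omega
    · have e2 : P.getD (i + 1) true = true := List.getD_eq_default _ _ (by omega)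
      simp only [hi, hi', true_and, false_imp_iff, and_true, e2]
      split at e1 <;> simp_all
      omega
  · simp [hi]

theorem ht_step (P : BinPath) {x : ℕ} (hx : x < P.length) :
    ht P (x + 1) = ht P x + 1 ∨ ht P (x + 1) = ht P x - 1 := by
  rw [ht_succ hx]
  split <;> simp [sub_eq_add_neg]

theorem sameValleysUpTo_of_pinnedUpTo {P Q : BinPath} (hle : pathLe P Q) {m : ℤ}
    (h : PinnedUpTo P Q m) : sameValleysUpTo P Q m := by
  intro i t ht
  rw [isValley_iff, isValley_iff, ← hle.1]
  have l0 := hle.2 i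
  have l1 := hle.2 (i + 1)
  have l2 := hle.2 (i + 2)
  have p0 := h i
  have p1 := h (i + 1)
  have p2 := h (i + 2)
  constructor
  · rintro ⟨⟨hi, h1, h2⟩, rfl⟩
    have s1 := ht_step Q (x := i) (by rw [← hle.1]; exact hi)
    have p1' := p1 ht
    refine ⟨⟨hi, by omega, fun hi' => ?_⟩, p1'⟩
    have s2 := ht_step Q (x := i + 1) (by rw [← hle.1]; exact hi')
    have h2' := h2 hi'
    rw [show i + 1 + 1 = i + 2 from rfl] at s2
    omega
  · rintro ⟨⟨hi, h1, h2⟩, rfl⟩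
    have s1 := ht_step P (x := i) hi
    have p1' := p1 (by omega)
    refine ⟨⟨hi, by omega, fun hi' => ?_⟩, p1'.symm⟩
    have s2 := ht_step P (x := i + 1) hi'
    have h2' := h2 hi'
    rw [show i + 1 + 1 = i + 2 from rfl] at s2
    omega

theorem pinnedUpTo_of_sameValleysUpTo {P Q : BinPath} (hle : pathLe P Q) {m : ℤ}
    (h : sameValleysUpTo P Q m) : PinnedUpTo P Q m := by
  intro x hx
  by_contra hne
  obtain ⟨i, hi, h1, h2⟩ := exists_isValley_of_lt hle.1 (lt_of_le_of_ne (hle.2 x) (Ne.symm hne))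
  exact h2.ne' ((h i _ (h1.trans hx)).1 ⟨hi, rfl⟩).2

theorem ht_le_hvNat {P : BinPath} {i : ℕ} (hi : isValley P i) : ht P (i + 1) ≤ hvNat P := by
  have : ht P (i + 1) ≤ hv P := by
    refine le_csSup ⟨P.length, ?_⟩ ⟨i, hi, rfl⟩
    rintro _ ⟨j, hj, rfl⟩
    have := hj.1
    rw [ht_eq_downCount hj.1]
    push_cast
    omega
  unfold hvNat
  omega

theorem eq_of_pinnedUpTo_hvNat {P Q : BinPath} (hle : pathLe P Q) {m : ℤ}
    (hm : (hvNat P : ℤ) ≤ m) (h : PinnedUpTo P Q m) : Q = P := by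
  refine eq_of_ht_eq hle.1.symm fun x => ?_
  by_contra hne
  obtain ⟨i, hi, -, h2⟩ := exists_isValley_of_lt hle.1 (lt_of_le_of_ne (hle.2 x) (Ne.symm hne))
  exact h2.ne' (h _ ((ht_le_hvNat hi).trans hm))

theorem isDyck_of_mem_pinnedFamilies {a : BinPath} (ha : IsDyck a) {Q : ℕ → BinPath}
    (hQ : Q ∈ pinnedFamilies a) (r : ℕ) : IsDyck (Q r) := by
  obtain ⟨h1, -, h3⟩ := hQ r
  refine ⟨?_, fun k => (ha.2 k).trans (h1.2 k)⟩
  rw [← h1.1, h3 _ (by rw [ha.1]; positivity), ha.1]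

theorem isVChain_of_mem_pinnedFamilies {a s : BinPath} (ha : IsDyck a) {Q : ℕ → BinPath}
    (hQ : Q ∈ pinnedFamilies a) (h0 : Q 0 = s) : IsVChain a s fun j => Q (hvNat a - j) := by
  refine ⟨?_, fun j hj => ?_, fun j => isDyck_of_mem_pinnedFamilies ha hQ _, fun j hj => ?_,
    fun j hj1 hj => ?_⟩
  · exact eq_of_pinnedUpTo_hvNat (hQ _).1 le_rfl (hQ _).2.2
  · simp only [Nat.sub_eq_zero_of_le hj, h0]
  · simp only
    rw [show hvNat a - j = hvNat a - (j + 1) + 1 by omega]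
    exact (hQ _).2.1
  · intro i t ht
    rw [← sameValleysUpTo_of_pinnedUpTo (hQ (hvNat a - (j - 1))).1 (hQ _).2.2 i t (by omega),
      ← sameValleysUpTo_of_pinnedUpTo (hQ (hvNat a - j)).1 (hQ _).2.2 i t (by omega)]

theorem mem_pinnedFamilies_of_isVChain {a s : BinPath} {σ : ℕ → BinPath}
    (hσ : IsVChain a s σ) : (fun r => σ (hvNat a - r)) ∈ pinnedFamilies a := by
  obtain ⟨h0, hs, -, hle, hsame⟩ := hσ
  have key : ∀ j ≤ hvNat a, pathLe a (σ j) ∧ sameValleysUpTo a (σ j) ((hvNat a : ℤ) - j) := by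
    intro j
    induction j with
    | zero =>
      intro _
      rw [h0]
      exact ⟨pathLe_refl a, fun _ _ _ => Iff.rfl⟩
    | succ j ih =>
      intro hj
      obtain ⟨i1, i2⟩ := ih (by omega)
      refine ⟨pathLe_trans i1 (hle j hj), fun i t ht => ?_⟩
      rw [i2 i t (by push_cast at ht; omega)]
      simpa using hsame (j + 1) (by omega) hj i t ht
  refine fun r => ⟨(key _ (by omega)).1, ?_, ?_⟩
  · by_cases hr : r < hvNat a
    · simp only
      rw [show hvNat a - r = hvNat a - (r + 1) + 1 by omega]
      exact hle _ (by omega)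
    · simp only [show hvNat a - (r + 1) = hvNat a - r by omega]
      exact pathLe_refl _
  · by_cases hr : r ≤ hvNat a
    · obtain ⟨k1, k2⟩ := key (hvNat a - r) (by omega)
      have := pinnedUpTo_of_sameValleysUpTo k1 k2
      rwa [show ((hvNat a : ℤ) - ((hvNat a - r : ℕ) : ℤ)) = r by omega] at this
    · intro x _
      simp only
      rw [show hvNat a - r = 0 by omega, h0]

theorem finite_eventuallyConst (N K : ℕ) (X : BinPath) :
    {c : ℕ → BinPath | (∀ t, (c t).length = N) ∧ ∀ t, K ≤ t → c t = X}.Finite := by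
  refine Set.Finite.of_finite_image (f := fun c (i : Fin K) => c i) ?_ ?_
  · refine (Set.Finite.pi' fun _ : Fin K => List.finite_length_eq Bool N).subset ?_
    rintro _ ⟨c, hc, rfl⟩ i
    exact hc.1 i
  · intro c hc d hd h
    funext t
    by_cases ht : K ≤ t
    · rw [hc.2 t ht, hd.2 t ht]
    · exact congrFun h ⟨t, by omega⟩

theorem finite_pinnedFamilies (a : BinPath) : (pinnedFamilies a).Finite :=
  (finite_eventuallyConst a.length (hvNat a) a).subset fun _ hQ =>
    ⟨length_of_mem_pinnedFamilies hQ, fun r hr =>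
      eq_of_pinnedUpTo_hvNat (hQ r).1 (by exact_mod_cast hr) (hQ r).2.2⟩

theorem VPath_eq_ncard {a : BinPath} (ha : IsDyck a) (s : BinPath) :
    VPath a s = {Q ∈ pinnedFamilies a | Q 0 = s}.ncard := by
  refine Set.ncard_congr (fun σ _ r => σ (hvNat a - r)) ?_ ?_ ?_
  · intro σ hσ
    exact ⟨mem_pinnedFamilies_of_isVChain hσ, hσ.2.1 _ (by simp)⟩
  · intro σ τ hσ hτ h
    funext j
    by_cases hj : j ≤ hvNat a
    · have := congrFun h (hvNat a - j)
      simpa [Nat.sub_sub_self hj] using this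
    · rw [hσ.2.1 j (by omega), hτ.2.1 j (by omega)]
  · rintro Q ⟨hQ, h0⟩
    refine ⟨fun j => Q (hvNat a - j), isVChain_of_mem_pinnedFamilies ha hQ h0, ?_⟩
    funext r
    by_cases hr : r ≤ hvNat a
    · simp [Nat.sub_sub_self hr]
    · simp only [show hvNat a - (hvNat a - r) = hvNat a by omega]
      rw [eq_of_pinnedUpTo_hvNat (hQ _).1 le_rfl (hQ _).2.2,
        eq_of_pinnedUpTo_hvNat (hQ r).1 (by omega) (hQ r).2.2]

/-! ### Summing over pinned families -/

open scoped ENNReal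

/-- The sum of the weights of the initial members of the pinned families of `P`. -/
noncomputable def familySum (P : BinPath) (w : BinPath → ℝ≥0∞) : ℝ≥0∞ :=
  ∑' Q : pinnedFamilies P, w ((Q : ℕ → BinPath) 0)

open Classical in
theorem familySum_of_isDyck {a : BinPath} (ha : IsDyck a) (w : BinPath → ℝ≥0∞) :
    familySum a w = ∑' s, if IsDyck s ∧ s.length = a.length ∧ pathLe a s then
      (VPath a s : ℝ≥0∞) * w s else 0 := by
  have h1 : familySum a w = ∑' s, ∑' Q : pinnedFamilies a,
      if s = (Q : ℕ → BinPath) 0 then w s else 0 := by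
    rw [ENNReal.tsum_comm]
    exact tsum_congr fun Q => (tsum_ite_eq _ _).symm
  rw [h1]
  refine tsum_congr fun s => ?_
  split_ifs with hs
  · have hfin : {Q ∈ pinnedFamilies a | Q 0 = s}.Finite :=
      (finite_pinnedFamilies a).subset fun _ h => h.1
    rw [VPath_eq_ncard ha, ← ENat.toENNReal_coe, hfin.cast_ncard_eq, ← ENNReal.tsum_set_one,
      tsum_subtype {Q ∈ pinnedFamilies a | Q 0 = s} fun _ => (1 : ℝ≥0∞),
      ← ENNReal.tsum_mul_right]
    rw [tsum_subtype (pinnedFamilies a) fun Q => if s = Q 0 then w s else 0]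
    refine tsum_congr fun Q => ?_
    by_cases hQ : Q ∈ pinnedFamilies a <;> by_cases hQ0 : Q 0 = s <;>
      simp [Set.indicator, hQ, hQ0, eq_comm (a := s)]
  · refine ENNReal.tsum_eq_zero.2 fun Q => if_neg ?_
    rintro rfl
    exact hs ⟨isDyck_of_mem_pinnedFamilies ha Q.2 0, length_of_mem_pinnedFamilies Q.2 0,
      pinnedFamilies_le Q.2 0⟩

theorem ht_append_cons_left (P R : BinPath) {x : ℕ} (hx : x ≤ P.length) :
    ht (P ++ R) x = ht P x := by
  rw [ht_append, Nat.sub_eq_zero_of_le hx, ht_zero, add_zero]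

theorem ht_append_cons_right {P : BinPath} (hP : ht P P.length = 0) (R : BinPath) (x : ℕ) :
    ht (P ++ true :: R) (P.length + 1 + x) = 1 + ht R x := by
  rw [ht_append, ht_of_length_le (by omega), hP,
    show P.length + 1 + x - P.length = x + 1 by omega, ht_cons_succ]
  simp

theorem le_length_or_exists (P : BinPath) (x : ℕ) :
    x ≤ P.length ∨ ∃ y, x = P.length + 1 + y := by
  by_cases h : x ≤ P.length
  · exact Or.inl h
  · exact Or.inr ⟨x - (P.length + 1), by omega⟩

theorem pathLe_append {P P' R R' : BinPath} (h : pathLe P P') (h' : pathLe R R') :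
    pathLe (P ++ R) (P' ++ R') := by
  refine ⟨by simp [h.1, h'.1], fun k => ?_⟩
  rw [ht_append, ht_append, ← h.1]
  exact add_le_add (h.2 k) (h'.2 _)

theorem pathLe_cons_iff {b : Bool} {P Q : BinPath} : pathLe (b :: P) (b :: Q) ↔ pathLe P Q := by
  constructor
  · rintro ⟨h1, h2⟩
    refine ⟨by simpa using h1, fun k => ?_⟩
    have := h2 (k + 1)
    rw [ht_cons_succ, ht_cons_succ] at this
    omega
  · rintro ⟨h1, h2⟩
    refine ⟨by simpa using h1, fun k => ?_⟩
    rcases k with _ | k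
    · simp [ht_zero]
    · rw [ht_cons_succ, ht_cons_succ]
      have := h2 k
      omega

theorem pathLe_take {P Q : BinPath} (h : pathLe P Q) (m : ℕ) : pathLe (P.take m) (Q.take m) :=
  ⟨by simp [h.1], fun k => by rw [ht_take, ht_take]; exact h.2 _⟩

theorem pathLe_drop {P Q : BinPath} (h : pathLe P Q) {m : ℕ} (hm : ht P m = ht Q m) :
    pathLe (P.drop m) (Q.drop m) :=
  ⟨by simp [h.1], fun k => by
    rw [ht_drop, ht_drop, hm]
    have := h.2 (m + k)
    omega⟩

/-- A pair of pinned families, for a Dyck path and for what follows it, together with a path above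
the initial member of the second one. -/
def gluingData (a P : BinPath) : Set ((pinnedFamilies a × pinnedFamilies P) × BinPath) :=
  {y | pathLe (true :: (y.1.2 : ℕ → BinPath) 0) y.2}

theorem mem_pinnedFamilies_append {a P : BinPath} (ha : IsDyck a) (hP : ∀ k, 0 ≤ ht P k)
    {τ ρ : ℕ → BinPath} {V : BinPath} (hτ : τ ∈ pinnedFamilies a) (hρ : ρ ∈ pinnedFamilies P)
    (hV : pathLe (true :: ρ 0) V) :
    (fun r => Nat.casesOn r (τ 0 ++ V) fun r => τ (r + 1) ++ true :: ρ r : ℕ → BinPath) ∈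
      pinnedFamilies (a ++ true :: P) := by
  have hlτ := length_of_mem_pinnedFamilies hτ
  intro r
  refine ⟨?_, ?_, ?_⟩
  · rcases r with _ | r
    · exact pathLe_append (hτ 0).1 (pathLe_trans (pathLe_cons_iff.2 (hρ 0).1) hV)
    · exact pathLe_append (hτ _).1 (pathLe_cons_iff.2 (hρ r).1)
  · rcases r with _ | r
    · exact pathLe_append (hτ 0).2.1 hV
    · exact pathLe_append (hτ _).2.1 (pathLe_cons_iff.2 (hρ r).2.1)
  · intro x hx
    rcases r with _ | r
    · show ht (τ 0 ++ V) x = _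
      rcases le_length_or_exists a x with h | ⟨y, rfl⟩
      · rw [ht_append_cons_left _ _ h] at hx ⊢
        rw [ht_append_cons_left _ _ (by rw [hlτ]; exact h)]
        exact (hτ 0).2.2 x hx
      · rw [ht_append_cons_right ha.1] at hx
        have := hP y
        push_cast at hx
        omega
    · show ht (τ (r + 1) ++ true :: ρ r) x = _
      rcases le_length_or_exists a x with h | ⟨y, rfl⟩
      · rw [ht_append_cons_left _ _ h] at hx ⊢
        rw [ht_append_cons_left _ _ (by rw [hlτ]; exact h)]
        exact (hτ (r + 1)).2.2 x hx
      · rw [ht_append_cons_right ha.1] at hx ⊢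
        have := (isDyck_of_mem_pinnedFamilies ha hτ (r + 1)).1
        rw [← hlτ (r + 1), ht_append_cons_right this, (hρ r).2.2 y (by push_cast at hx; omega)]

section Split

variable {a P : BinPath} {Q : ℕ → BinPath}

theorem ht_length_of_mem_pinnedFamilies_append (ha : IsDyck a)
    (hQ : Q ∈ pinnedFamilies (a ++ true :: P)) (r : ℕ) : ht (Q r) a.length = 0 := by
  have h : ht (a ++ true :: P) a.length = 0 := by rw [ht_append_cons_left _ _ le_rfl, ha.1]
  rw [(hQ r).2.2 _ (by rw [h]; positivity), h]

theorem ht_length_add_one_of_mem_pinnedFamilies_append (ha : IsDyck a)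
    (hQ : Q ∈ pinnedFamilies (a ++ true :: P)) (r : ℕ) :
    ht (Q (r + 1)) (a.length + 1) = 1 := by
  have h : ht (a ++ true :: P) (a.length + 1) = 1 := by
    have := ht_append_cons_right ha.1 P 0
    rwa [ht_zero] at this
  rw [(hQ (r + 1)).2.2 _ (by rw [h]; push_cast; omega), h]

theorem drop_length_eq_cons (ha : IsDyck a) (hQ : Q ∈ pinnedFamilies (a ++ true :: P)) (r : ℕ) :
    (Q (r + 1)).drop a.length = true :: (Q (r + 1)).drop (a.length + 1) := by
  have := eq_cons_tail_of_ht_one (P := (Q (r + 1)).drop a.length) (by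
    rw [ht_drop, ht_length_of_mem_pinnedFamilies_append ha hQ,
      ht_length_add_one_of_mem_pinnedFamilies_append ha hQ, sub_zero])
  rwa [List.tail_drop] at this

theorem take_mem_pinnedFamilies (hQ : Q ∈ pinnedFamilies (a ++ true :: P)) :
    (fun r => (Q r).take a.length) ∈ pinnedFamilies a := by
  have h : a = (a ++ true :: P).take a.length := by simp
  intro r
  refine ⟨?_, pathLe_take (hQ r).2.1 _, fun x hx => ?_⟩
  · conv_lhs => rw [h]
    exact pathLe_take (hQ r).1 _
  · rw [h, ht_take] at hx ⊢
    simp only [List.length_take_of_le, List.length_append, Nat.le_add_right] at hx ⊢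
    rw [ht_take]
    exact (hQ r).2.2 _ hx

theorem drop_mem_pinnedFamilies (ha : IsDyck a) (hQ : Q ∈ pinnedFamilies (a ++ true :: P)) :
    (fun r => (Q (r + 1)).drop (a.length + 1)) ∈ pinnedFamilies P := by
  have h : P = (a ++ true :: P).drop (a.length + 1) := by simp [List.drop_append]
  have h1 := ht_length_add_one_of_mem_pinnedFamilies_append ha hQ
  intro r
  refine ⟨?_, pathLe_drop (hQ (r + 1)).2.1 (by rw [h1, h1]), fun x hx => ?_⟩
  · conv_lhs => rw [h]
    refine pathLe_drop (hQ (r + 1)).1 ?_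
    rw [h1]
    simpa [ht_zero] using ht_append_cons_right ha.1 P 0
  · have h2 := ht_append_cons_right ha.1 P x
    rw [ht_drop, h1, (hQ (r + 1)).2.2 _ (by rw [h2]; push_cast; omega), h2]
    ring

/-- The decomposition of a pinned family of `a u P`. -/
def gluingEquiv (ha : IsDyck a) (hP : ∀ k, 0 ≤ ht P k) :
    pinnedFamilies (a ++ true :: P) ≃ gluingData a P where
  toFun Q := ⟨((⟨_, take_mem_pinnedFamilies Q.2⟩, ⟨_, drop_mem_pinnedFamilies ha Q.2⟩),
    ((Q : ℕ → BinPath) 0).drop a.length), by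
      show pathLe (true :: ((Q : ℕ → BinPath) 1).drop (a.length + 1)) _
      rw [← drop_length_eq_cons ha Q.2 0]
      refine pathLe_drop (Q.2 0).2.1 ?_
      rw [ht_length_of_mem_pinnedFamilies_append ha Q.2,
        ht_length_of_mem_pinnedFamilies_append ha Q.2]⟩
  invFun y := ⟨_, mem_pinnedFamilies_append ha hP y.1.1.1.2 y.1.1.2.2 y.2⟩
  left_inv Q := by
    refine Subtype.ext (funext fun r => ?_)
    rcases r with _ | r
    · exact List.take_append_drop _ _
    · show _ ++ true :: _ = _
      rw [← drop_length_eq_cons ha Q.2 r, List.take_append_drop]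
  right_inv y := by
    obtain ⟨⟨⟨τ, ρ⟩, V⟩, h⟩ := y
    have hτ := length_of_mem_pinnedFamilies τ.2
    refine Subtype.ext (Prod.ext (Prod.ext (Subtype.ext (funext fun r => ?_))
      (Subtype.ext (funext fun r => ?_))) ?_)
    · rcases r with _ | r <;> exact List.take_left' (hτ _)
    · show List.drop (a.length + 1) ((τ : ℕ → BinPath) (r + 1) ++ true :: (ρ : ℕ → BinPath) r) = _
      rw [← hτ (r + 1)]
      simp [List.drop_append]
    · exact List.drop_left' (hτ 0)

end Split

open Classical in
theorem familySum_append {a P : BinPath} (ha : IsDyck a) (hP : ∀ k, 0 ≤ ht P k)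
    (w : BinPath → ℝ≥0∞) :
    familySum (a ++ true :: P) w = familySum a fun s => familySum P fun X =>
      ∑' V, if pathLe (true :: X) V then w (s ++ V) else 0 := by
  unfold familySum
  rw [← (gluingEquiv ha hP).symm.tsum_eq]
  have h (y : gluingData a P) : w (((gluingEquiv ha hP).symm y : ℕ → BinPath) 0) =
    w ((y.1.1.1 : ℕ → BinPath) 0 ++ y.1.2) := rfl
  simp_rw [h]
  rw [tsum_subtype (gluingData a P) fun y => w ((y.1.1 : ℕ → BinPath) 0 ++ y.2),
    ENNReal.tsum_prod', ENNReal.tsum_prod']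
  rfl

/-! ### Iterating the decomposition -/

theorem ht_replicate_false (m k : ℕ) : ht (List.replicate m false) k = -(min k m : ℕ) := by
  induction m generalizing k with
  | zero => simp [ht_nil]
  | succ m ih =>
    rcases k with _ | k
    · simp [ht_zero]
    · rw [List.replicate_succ, ht_cons_succ, ih]
      simp only [Bool.false_eq_true, if_false]
      omega

theorem isDyckPrefix_iff {P : BinPath} : IsDyckPrefix P ↔ ∀ k, 0 ≤ ht P k := by
  constructor
  · rintro ⟨Q, -, hQ⟩ k
    have := hQ (min k P.length)
    rwa [ht_append_cons_left _ _ (min_le_right _ _), ht_min_length] at this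
  · intro h
    have hm : ((ht P P.length).toNat : ℤ) = ht P P.length := Int.toNat_of_nonneg (h _)
    refine ⟨List.replicate (ht P P.length).toNat false, ?_, fun k => ?_⟩
    · rw [ht_append, ht_replicate_false, ht_of_length_le (by simp)]
      simp [hm]
    · rw [ht_append, ht_replicate_false]
      rcases le_or_gt k P.length with hk | hk
      · rw [Nat.sub_eq_zero_of_le hk]
        simpa using h k
      · rw [ht_of_length_le hk.le]
        omega

theorem isDyckPrefix_of_pathLe {P Q : BinPath} (hP : IsDyckPrefix P) (h : pathLe P Q) :
    IsDyckPrefix Q :=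
  isDyckPrefix_iff.2 fun k => (isDyckPrefix_iff.1 hP k).trans (h.2 k)

theorem IsDyck.isDyckPrefix_append {s P : BinPath} (hs : IsDyck s) (hP : IsDyckPrefix P) :
    IsDyckPrefix (s ++ P) :=
  isDyckPrefix_iff.2 fun k => by
    rw [ht_append]
    exact add_nonneg (hs.2 k) (isDyckPrefix_iff.1 hP _)

theorem isDyckPrefix_cons {P : BinPath} (hP : IsDyckPrefix P) : IsDyckPrefix (true :: P) :=
  isDyckPrefix_iff.2 fun k => by
    rcases k with _ | k
    · rw [ht_zero]
    · rw [ht_cons_succ]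
      have := isDyckPrefix_iff.1 hP k
      simp only [if_true]
      omega

theorem isDyckPrefix_nil : IsDyckPrefix [] := isDyckPrefix_iff.2 fun k => by rw [ht_nil]

/-- The Dyck prefix `a₀ u a₁ ⋯ u a_k`. -/
def uJoin {k : ℕ} (a : Fin (k + 1) → BinPath) : BinPath :=
  a 0 ++ (List.ofFn fun i : Fin k => true :: a i.succ).flatten

theorem uJoin_succ {k : ℕ} (a : Fin (k + 2) → BinPath) :
    uJoin a = a 0 ++ true :: uJoin (Fin.tail a) := by
  simp [uJoin, List.ofFn_succ, Fin.tail]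

theorem isDyckPrefix_uJoin {k : ℕ} {a : Fin (k + 1) → BinPath} (ha : ∀ i, IsDyck (a i)) :
    IsDyckPrefix (uJoin a) := by
  induction k with
  | zero => exact (ha 0).isDyckPrefix_append (by simpa using isDyckPrefix_nil)
  | succ k ih =>
    rw [uJoin_succ]
    exact (ha 0).isDyckPrefix_append (isDyckPrefix_cons (ih fun i => ha i.succ))

/-- The index set of the sum: sequences `(sᵢ)` of Dyck paths above the `aᵢ` and sequences of Dyck
prefixes ending in the empty path, each lying above `u sᵢ` followed by its successor. -/
def IsGluingSeq {k : ℕ} (a : Fin (k + 1) → BinPath)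
    (p : (Fin (k + 1) → BinPath) × (Fin (k + 1) → BinPath)) : Prop :=
  (∀ i, IsDyck (p.1 i) ∧ (p.1 i).length = (a i).length ∧ pathLe (a i) (p.1 i)) ∧
    (∀ i, IsDyckPrefix (p.2 i)) ∧ p.2 (Fin.last k) = [] ∧
    ∀ i : Fin k, pathLe (true :: (p.1 i.succ ++ p.2 i.succ)) (p.2 i.castSucc)

theorem isGluingSeq_cons {k : ℕ} {a : Fin (k + 2) → BinPath} {s V : BinPath}
    {t W : Fin (k + 1) → BinPath} :
    IsGluingSeq a (Fin.cons s t, Fin.cons V W) ↔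
      (IsDyck s ∧ s.length = (a 0).length ∧ pathLe (a 0) s) ∧
        IsGluingSeq (Fin.tail a) (t, W) ∧ pathLe (true :: (t 0 ++ W 0)) V := by
  simp only [IsGluingSeq]
  rw [Fin.forall_fin_succ, Fin.forall_fin_succ (P := fun i => IsDyckPrefix _),
    Fin.forall_fin_succ (n := k) (P := fun i => pathLe _ _), ← Fin.succ_last]
  simp only [Fin.cons_zero, Fin.cons_succ, Fin.castSucc_zero, Fin.castSucc_succ, Fin.tail]
  constructor
  · rintro ⟨⟨h1, h2⟩, ⟨h3, h4⟩, h5, h6, h7⟩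
    exact ⟨h1, ⟨h2, h4, h5, h7⟩, h6⟩
  · rintro ⟨h1, ⟨h2, h4, h5, h7⟩, h6⟩
    exact ⟨⟨h1, h2⟩, ⟨isDyckPrefix_of_pathLe
      (isDyckPrefix_cons ((h2 0).1.isDyckPrefix_append (h4 0))) h6, h4⟩, h5, h6, h7⟩

theorem tsum_fin_cons {k : ℕ} (g : (Fin (k + 1) → BinPath) → ℝ≥0∞) :
    ∑' p, g p = ∑' s, ∑' t : Fin k → BinPath, g (Fin.cons s t) := by
  rw [← (Fin.consEquiv fun _ : Fin (k + 1) => BinPath).tsum_eq, ENNReal.tsum_prod']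
  rfl

open Classical in
theorem familySum_uJoin {k : ℕ} {a : Fin (k + 1) → BinPath} (ha : ∀ i, IsDyck (a i))
    (w : BinPath → ℝ≥0∞) :
    familySum (uJoin a) w = ∑' p, if IsGluingSeq a p then
      (∏ i, (VPath (a i) (p.1 i) : ℝ≥0∞)) * w (p.1 0 ++ p.2 0) else 0 := by
  induction k generalizing w with
  | zero =>
    have h0 : uJoin a = a 0 := by simp [uJoin]
    rw [h0, familySum_of_isDyck (ha 0), ENNReal.tsum_prod', tsum_fin_cons]
    refine tsum_congr fun s => ?_
    rw [tsum_eq_single (default : Fin 0 → BinPath) fun t ht => absurd (Subsingleton.elim _ _) ht,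
      tsum_fin_cons, tsum_eq_single [], tsum_eq_single (default : Fin 0 → BinPath) fun t ht =>
        absurd (Subsingleton.elim _ _) ht]
    · simp [IsGluingSeq, Fin.forall_fin_one, isDyckPrefix_nil]
    · intro V hV
      rw [ENNReal.tsum_eq_zero]
      intro t
      rw [if_neg]
      exact fun h => hV h.2.2.1
  | succ k ih =>
    have ht : ∀ i, IsDyck (Fin.tail a i) := fun i => ha i.succ
    rw [uJoin_succ, familySum_append (ha 0) (isDyckPrefix_iff.1 (isDyckPrefix_uJoin ht)),
      familySum_of_isDyck (ha 0), ENNReal.tsum_prod', tsum_fin_cons]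
    refine tsum_congr fun s => ?_
    rw [ih ht]
    simp_rw [tsum_fin_cons (k := k + 1), isGluingSeq_cons]
    split_ifs with hs
    · rw [ENNReal.tsum_prod', ← ENNReal.tsum_mul_left]
      refine tsum_congr fun t => ?_
      rw [ENNReal.tsum_comm, ← ENNReal.tsum_mul_left]
      refine tsum_congr fun W => ?_
      by_cases hW : IsGluingSeq (Fin.tail a) (t, W)
      · simp only [hW, hs, if_true, true_and, ← ENNReal.tsum_mul_left]
        refine tsum_congr fun V => ?_
        by_cases hV : pathLe (true :: (t 0 ++ W 0)) V
        · simp only [hV, if_true]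
          rw [Fin.prod_univ_succ (n := k + 1)]
          simp only [Fin.cons_zero, Fin.cons_succ, Fin.tail, mul_assoc]
        · simp [hV]
      · simp [hW]
    · simp [hs]

/-! ### Counting the chains -/

open Classical in
theorem natCast_Jfun (X : BinPath) :
    (Jfun X : ℝ≥0∞) = ∑' V, if pathLe (true :: X) V then 1 else 0 := by
  have himg : {V | pathLe (true :: X) V} =
      List.cons true '' {R | pathLe X R ∧ pathLe R (maxPath X.length)} := by
    ext V
    constructor
    · intro hV
      have hl : V.length = X.length + 1 := hV.1.symm
      have h1 : ht V 1 = 1 := by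
        have := hV.2 1
        have e := ht_eq_downCount (P := V) (x := 1) (by omega)
        rw [ht_cons_succ, ht_zero] at this
        simp only [if_true, Nat.cast_one] at this e
        omega
      have hcons := eq_cons_tail_of_ht_one h1
      refine ⟨V.tail, ⟨?_, pathLe_maxPath (by simp [hl])⟩, hcons.symm⟩
      have h : pathLe (true :: X) V := hV
      rw [hcons] at h
      exact pathLe_cons_iff.1 h
    · rintro ⟨R, hR, rfl⟩
      exact pathLe_cons_iff.2 hR.1
  have hfin : {V | pathLe (true :: X) V}.Finite :=
    (List.finite_length_eq Bool (X.length + 1)).subset fun V hV => hV.1.symm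
  rw [Jfun, intervalCard, ← Set.ncard_image_of_injective _ List.cons_injective, ← himg,
    ← ENat.toENNReal_coe, hfin.cast_ncard_eq, ← ENNReal.tsum_set_one,
    tsum_subtype {V | pathLe (true :: X) V} fun _ => (1 : ℝ≥0∞)]
  exact tsum_congr fun V => by simp [Set.indicator]

theorem familySum_nil (w : BinPath → ℝ≥0∞) : familySum [] w = w [] := by
  have hmem : (fun _ => []) ∈ pinnedFamilies [] := fun r =>
    ⟨pathLe_refl _, pathLe_refl _, fun _ _ => rfl⟩
  refine (tsum_eq_single ⟨_, hmem⟩ fun Q hQ => ?_).trans rfl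
  refine absurd (Subtype.ext (funext fun r => ?_)) hQ
  exact List.length_eq_zero_iff.1 (length_of_mem_pinnedFamilies Q.2 r)

theorem natCast_fPath {P : BinPath} (hP : IsDyckPrefix P) :
    (fPath (false :: true :: P) : ℝ≥0∞) = familySum P fun X => (Jfun X : ℝ≥0∞) := by
  have h0 := isDyckPrefix_iff.1 hP
  have hU := isDyckPrefix_iff.1 (isDyckPrefix_cons hP)
  have hlow : ∀ x ≤ (true :: P).length + 1,
      downCount (false :: true :: P) x ≤ (x + 1) / 2 := by
    intro x hx
    have e := ht_eq_downCount (P := false :: true :: P) (x := x) (by simpa using hx)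
    rcases x with _ | x
    · simp [downCount]
    · rw [ht_cons_succ] at e
      have := hU x
      simp only [Bool.false_eq_true, if_false] at e
      push_cast at e
      omega
  rw [fPath_eq_ncard_fillChains (N := (true :: P).length + 1) rfl hlow (by simp [downCount]),
    ← Nat.card_coe_set_eq, Nat.card_congr
      ((fillChainsEquiv (N := (true :: P).length + 1) rfl).trans (levelFamiliesEquiv hU)),
    Nat.card_coe_set_eq, ← ENat.toENNReal_coe, (finite_pinnedFamilies _).cast_ncard_eq,
    ← ENNReal.tsum_set_one]
  have h := familySum_append (a := []) ⟨ht_zero _, fun k => (ht_nil k).ge⟩ h0 1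
  rw [familySum_nil] at h
  simp_rw [natCast_Jfun]
  exact h

theorem finsum_eq_of_tsum_natCast_eq {ι : Type*} {g : ι → ℕ} {n : ℕ}
    (h : ∑' i, (g i : ℝ≥0∞) = n) : ∑ᶠ i, g i = n := by
  have hfin : (Function.support g).Finite := by
    refine (ENNReal.finite_const_le_of_tsum_ne_top (a := fun i => (g i : ℝ≥0∞))
      (h ▸ ENNReal.natCast_ne_top n) one_ne_zero).subset fun i hi => ?_
    exact_mod_cast Nat.one_le_iff_ne_zero.2 hi
  rw [finsum_eq_sum_of_support_subset (s := hfin.toFinset) g (by simp)]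
  rw [tsum_eq_sum (s := hfin.toFinset) fun i hi => by simpa using hi] at h
  exact_mod_cast h

/-- For every Dyck prefix `P = a₀ u a₁ ⋯ u a_k`,
`f(duP) = Σ Π_{i=0}^k V(aᵢ, sᵢ) · J(s₀V₁)`, summed over all sequences `(sᵢ)` of
Dyck paths with `|sᵢ| = |aᵢ|`, `sᵢ ≥ aᵢ`, and all sequences `(Vᵢ)_{i∈[k+1]}` of
Dyck prefixes with `Vᵢ ≥ u sᵢ V_{i+1}` for `i ∈ [k]` and `V_{k+1} = ε`.
(Below `p.1 i` is `sᵢ` for `i ∈ [0,k]` and `p.2 i` is `V_{i+1}` for `i ∈ [0,k]`.) -/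
theorem statement18 (k : ℕ) (a : Fin (k + 1) → BinPath) (ha : ∀ i, IsDyck (a i))
    (P : BinPath)
    (hP : P = a 0 ++ (List.ofFn fun i : Fin k => true :: a i.succ).flatten) :
    fPath (false :: true :: P)
      = ∑ᶠ (p : (Fin (k + 1) → BinPath) × (Fin (k + 1) → BinPath))
          (_ : (∀ i, IsDyck (p.1 i) ∧ (p.1 i).length = (a i).length ∧
                  pathLe (a i) (p.1 i)) ∧
               (∀ i, IsDyckPrefix (p.2 i)) ∧
               p.2 (Fin.last k) = [] ∧
               (∀ i : Fin k,
                 pathLe (true :: (p.1 i.succ ++ p.2 i.succ)) (p.2 i.castSucc))),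
          (∏ i, VPath (a i) (p.1 i)) * Jfun (p.1 0 ++ p.2 0) := by
  classical
  refine (finsum_eq_of_tsum_natCast_eq ?_).symm
  rw [show P = uJoin a from hP, natCast_fPath (isDyckPrefix_uJoin ha)]
  refine Eq.trans (tsum_congr fun p => ?_) (familySum_uJoin ha _).symm
  rw [finsum_eq_if]
  unfold IsGluingSeq
  split_ifs <;> push_cast <;> rfl
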